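/- Let X be a type, N a positive natural number, and φ̃ : (Fin N → X) → ℝ an arbitrary function. Define φ(x) = ∑_{σ ∈ P₁} φ̃(x ∘ σ), where P₁ is the set of permutations of Fin N fixing index 0, and define γ_i(x) = exp(φ(x ∘ swap(0,i))) / ∑_{j ∈ Fin N} exp(φ(x ∘ swap(0,j))). Then for all indices i, j : Fin N and all x : Fin N → X, γ_i(x) = γ_j(x ∘ swap(i,j)); that is, a given agent's responsibility allocation is unchanged if its assigned index is swapped with that of another agent. -/

import Mathlib

/-- A sum over the stabilizer of a point, evaluated along `x ∘ π`, depends on the permutation `π`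
only through the image of that point. -/
theorem sum_stabilizer_comp_congr {ι X M : Type*} [Fintype ι] [DecidableEq ι] [AddCommMonoid M]
    (f : (ι → X) → M) (a : ι) (x : ι → X) {π ρ : Equiv.Perm ι} (h : π a = ρ a) :
    ∑ σ ∈ Finset.univ.filter (fun σ : Equiv.Perm ι => σ a = a), f ((x ∘ π) ∘ σ) =
      ∑ σ ∈ Finset.univ.filter (fun σ : Equiv.Perm ι => σ a = a), f ((x ∘ ρ) ∘ σ) := by
  refine Finset.sum_equiv (Equiv.mulLeft (ρ⁻¹ * π)) (fun σ => ?_) (fun σ _ => ?_)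
  · simp [Equiv.symm_apply_eq, ← h]
  · congr 1
    ext k
    simp

/-- With `φ(x) = ∑_{σ ∈ P₁} φ̃(x ∘ σ)` and
`γ_i(x) = exp(φ(x ∘ swap 0 i)) / ∑_j exp(φ(x ∘ swap 0 j))`, a given agent's responsibility
allocation is unchanged if its index is swapped with that of another agent:
`γ_i(x) = γ_j(x ∘ swap i j)` (property (13)). -/
theorem gamma_relabeling_invariance
    {X : Type*} (N : ℕ) [NeZero N]
    (φt : (Fin N → X) → ℝ)
    (φ : (Fin N → X) → ℝ)
    (hφ : ∀ x : Fin N → X,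
      φ x = ∑ σ ∈ Finset.univ.filter (fun σ : Equiv.Perm (Fin N) => σ 0 = 0), φt (x ∘ σ))
    (γ : Fin N → (Fin N → X) → ℝ)
    (hγ : ∀ (i : Fin N) (x : Fin N → X),
      γ i x = Real.exp (φ (x ∘ Equiv.swap 0 i))
        / ∑ j : Fin N, Real.exp (φ (x ∘ Equiv.swap 0 j))) :
    ∀ (i j : Fin N) (x : Fin N → X), γ i x = γ j (x ∘ Equiv.swap i j) := by
  intro i j x
  have key : ∀ k : Fin N,
      φ ((x ∘ Equiv.swap i j) ∘ Equiv.swap 0 k) = φ (x ∘ Equiv.swap 0 (Equiv.swap i j k)) := by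
    intro k
    rw [hφ, hφ]
    exact sum_stabilizer_comp_congr φt 0 x
      (π := Equiv.swap i j * Equiv.swap 0 k) (ρ := Equiv.swap 0 (Equiv.swap i j k)) (by simp)
  rw [hγ, hγ]
  simp only [key, Equiv.swap_apply_right]
  rw [Equiv.sum_comp (Equiv.swap i j) fun k => Real.exp (φ (x ∘ Equiv.swap 0 k))]
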